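/- arXiv:2510.00870 — 7 statements merged into one kernel-verified Lean document; each statement's English description precedes it below -/
import Mathlib

section
/- ∫₀¹ log(x³ + 1)/(x + 1) dx = (1/2)·Li₂(3/4) + (3/2)·log²2 − π²/9. -/
open Real MeasureTheory intervalIntegral Finset

/-- Dilogarithm Li₂(z) = Σ_{k≥1} z^k/k². -/
noncomputable def Li2 (x : ℝ) : ℝ := ∑' k : ℕ, x ^ (k + 1) / ((k : ℝ) + 1) ^ 2


lemma Li2_summand_bound (k : ℕ) (x : ℝ) (hx : |x| ≤ 1) :
    ‖x ^ (k + 1) / ((k : ℝ) + 1) ^ 2‖ ≤ 1 / ((k : ℝ) + 1) ^ 2 := by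
  rw [norm_div, norm_pow, Real.norm_eq_abs, Real.norm_of_nonneg (by positivity : (0:ℝ) ≤ ((k:ℝ)+1)^2)]
  gcongr
  exact pow_le_one₀ (abs_nonneg _) hx

lemma hasSum_sq : HasSum (fun k : ℕ => 1 / ((k : ℝ) + 1) ^ 2) (π ^ 2 / 6) := by
  have h := (hasSum_nat_add_iff' (f := fun n : ℕ => (1 : ℝ) / (n : ℝ) ^ 2) 1).2 hasSum_zeta_two
  simpa using h

lemma Li2_summable (x : ℝ) (hx : |x| ≤ 1) :
    Summable (fun k : ℕ => x ^ (k + 1) / ((k : ℝ) + 1) ^ 2) :=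
  Summable.of_norm_bounded hasSum_sq.summable (fun k => Li2_summand_bound k x hx)

lemma Li2_cont : ContinuousOn Li2 (Set.Icc (-1) 1) := by
  unfold Li2
  refine continuousOn_tsum (u := fun k : ℕ => 1 / ((k : ℝ) + 1) ^ 2) (fun k => ?_) hasSum_sq.summable
    (fun k x hx => Li2_summand_bound k x (abs_le.2 hx))
  fun_prop

lemma Li2_zero : Li2 0 = 0 := by
  simp [Li2]

lemma Li2_neg_one : Li2 (-1) = -(π ^ 2 / 12) := by
  have h1 := hasSum_sq
  have h2 := (Li2_summable (-1) (by simp)).hasSum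
  have h3 := h1.add h2
  have he : HasSum (fun m : ℕ => (fun k : ℕ => 1 / ((k : ℝ) + 1) ^ 2 + (-1:ℝ) ^ (k + 1) / ((k : ℝ) + 1) ^ 2) (2 * m)) 0 := by
    convert hasSum_zero using 1
    funext m
    have : (-1 : ℝ) ^ (2 * m + 1) = -1 := by rw [pow_succ, pow_mul]; simp
    simp only [this]; ring
  have ho : HasSum (fun m : ℕ => (fun k : ℕ => 1 / ((k : ℝ) + 1) ^ 2 + (-1:ℝ) ^ (k + 1) / ((k : ℝ) + 1) ^ 2) (2 * m + 1)) ((1/2) * (π ^ 2 / 6)) := by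
    convert! h1.mul_left (1/2) using 1
    funext m
    have : (-1 : ℝ) ^ (2 * m + 1 + 1) = 1 := by rw [pow_succ, pow_succ, pow_mul]; simp
    simp only [this]
    push_cast
    have : (m:ℝ) + 1 ≠ 0 := by positivity
    have : (2 * m:ℝ) + 1 + 1 ≠ 0 := by positivity
    field_simp
    ring
  have h4 := h3.unique (he.even_add_odd ho)
  change π ^ 2 / 6 + Li2 (-1) = _ at h4
  linarith

lemma Li2_deriv (x : ℝ) (hx : |x| < 1) (h0 : x ≠ 0) :
    HasDerivAt Li2 (-Real.log (1 - x) / x) x := by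
  obtain ⟨r, hr, hr1⟩ := exists_between hx
  have hr0 : 0 < r := (abs_nonneg x).trans_lt hr
  have key : HasDerivAt Li2 (∑' k : ℕ, x ^ k / ((k : ℝ) + 1)) x := by
    unfold Li2
    refine hasDerivAt_tsum_of_isPreconnected (u := fun k => r ^ k) (t := Set.Ioo (-r) r)
      (g := fun (k : ℕ) (x : ℝ) => x ^ (k + 1) / ((k : ℝ) + 1) ^ 2)
      (g' := fun (k : ℕ) (x : ℝ) => x ^ k / ((k : ℝ) + 1)) (y₀ := 0)
      (summable_geometric_of_lt_one hr0.le hr1) isOpen_Ioo isPreconnected_Ioo ?_ ?_ ?_ ?_ ?_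
    · intro k y _
      have := (hasDerivAt_pow (k + 1) y).div_const (((k : ℝ) + 1) ^ 2)
      refine this.congr_deriv ?_
      have : (k:ℝ) + 1 ≠ 0 := by positivity
      push_cast
      field_simp
    · intro k y hy
      have hk : (1:ℝ) ≤ (k:ℝ) + 1 := by simp
      rw [norm_div, norm_pow, Real.norm_eq_abs, Real.norm_of_nonneg (by positivity : (0:ℝ) ≤ (k:ℝ)+1)]
      calc |y| ^ k / ((k:ℝ) + 1) ≤ |y| ^ k := div_le_self (by positivity) hk
        _ ≤ r ^ k := by
          gcongr
          exact (abs_lt.2 hy).le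
    · simp [hr0]
    · simp [summable_zero]
    · exact abs_lt.1 hr
  convert key using 1
  have h := (hasSum_pow_div_log_of_abs_lt_one hx).div_const x
  rw [← h.tsum_eq]
  congr 1
  funext k
  field_simp
  ring

theorem stmt_12 :
    ∫ x in (0:ℝ)..1, Real.log (x ^ 3 + 1) / (x + 1) =
      (1 / 2) * Li2 (3 / 4) + (3 / 2) * Real.log 2 ^ 2 - π ^ 2 / 9 := by
  have hs : ∀ x : ℝ, 0 ≤ x → 3 * x / (1 + x) ^ 2 ≤ 3 / 4 := by
    intro x hx
    rw [div_le_div_iff₀ (by positivity) (by norm_num)]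
    nlinarith [sq_nonneg (x - 1)]
  have main := integral_eq_sub_of_hasDerivAt_of_le (a := 0) (b := 1)
    (f := fun x : ℝ => (3/2) * Real.log (1 + x) ^ 2
      + (1/2) * (-(1/3) * Li2 (-x ^ 3) + 3 * Li2 (-x)) + (1/2) * Li2 (3 * x / (1 + x) ^ 2))
    (f' := fun x : ℝ => Real.log (x ^ 3 + 1) / (x + 1)) (by norm_num) ?_ ?_ ?_
  · rw [main]
    norm_num [Li2_zero, Li2_neg_one]
    ring
  · have hne : ∀ x ∈ Set.Icc (0:ℝ) 1, 1 + x ≠ 0 := fun x hx => by linarith [hx.1]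
    have c1 : ContinuousOn (fun x : ℝ => Li2 (-x ^ 3)) (Set.Icc 0 1) := by
      refine Li2_cont.comp (f := fun x : ℝ => -x ^ 3) (by fun_prop) ?_
      intro x hx
      have := pow_le_one₀ hx.1 hx.2 (n := 3)
      have := pow_nonneg hx.1 3
      constructor <;> linarith
    have c2 : ContinuousOn (fun x : ℝ => Li2 (-x)) (Set.Icc 0 1) := by
      refine Li2_cont.comp (f := fun x : ℝ => -x) (by fun_prop) ?_
      intro x hx
      constructor <;> linarith [hx.1, hx.2]
    have c3 : ContinuousOn (fun x : ℝ => Li2 (3 * x / (1 + x) ^ 2)) (Set.Icc 0 1) := by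
      refine Li2_cont.comp (f := fun x : ℝ => 3 * x / (1 + x) ^ 2)
        (ContinuousOn.div (by fun_prop) (by fun_prop) (fun x hx => pow_ne_zero _ (hne x hx))) ?_
      intro x hx
      have := hs x hx.1
      have h0 := hx.1
      have : 0 ≤ 3 * x / (1 + x) ^ 2 := by positivity
      constructor <;> linarith
    have c4 : ContinuousOn (fun x : ℝ => Real.log (1 + x)) (Set.Icc 0 1) :=
      ContinuousOn.log (by fun_prop) hne
    fun_prop
  · intro x hx
    obtain ⟨h0, h1⟩ := hx
    have hx3 : x ^ 3 < 1 := pow_lt_one₀ h0.le h1 (by norm_num)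
    have hx3' : 0 < x ^ 3 := by positivity
    have hp : 0 < 1 + x := by linarith
    have d1 := (((hasDerivAt_id x).const_add 1).log hp.ne').pow 2
    have e2 : HasDerivAt (fun x : ℝ => -x ^ 3) (-(3 * x ^ 2)) x := by
      exact (hasDerivAt_pow 3 x).neg.congr_deriv (by norm_num)
    have d2 := (Li2_deriv (-x ^ 3) (by rw [abs_lt]; constructor <;> linarith) (by linarith)).comp x e2
    have d3 := (Li2_deriv (-x) (by rw [abs_lt]; constructor <;> linarith) (by linarith)).comp x
      (hasDerivAt_neg x)
    have e4 := ((hasDerivAt_id x).const_mul 3).div (((hasDerivAt_id x).const_add 1).pow 2)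
      (pow_ne_zero 2 hp.ne')
    have hspos : 0 < 3 * x / (1 + x) ^ 2 := by positivity
    have d4 := (Li2_deriv (3 * x / (1 + x) ^ 2)
      (by rw [abs_lt]; constructor <;> linarith [hs x h0.le]) hspos.ne').comp x e4
    have tot := ((d1.const_mul (3/2)).add (((d2.const_mul (-(1/3))).add (d3.const_mul 3)).const_mul (1/2))).add
      (d4.const_mul (1/2))
    have hlog : Real.log (1 - 3 * x / (1 + x) ^ 2) = Real.log (x ^ 3 + 1) - 3 * Real.log (1 + x) := by
      have : 1 - 3 * x / (1 + x) ^ 2 = (x ^ 3 + 1) / (1 + x) ^ 3 := by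
        field_simp
        ring
      rw [this, Real.log_div (by positivity) (by positivity), Real.log_pow]
      norm_num
    refine (tot.congr_deriv ?_)
    rw [hlog]
    have t1 : 1 - -x ^ 3 = x ^ 3 + 1 := by ring
    have t2 : 1 - -x = 1 + x := by ring
    simp only [id, t1, t2]
    have : x + 1 ≠ 0 := by linarith
    have hx0 := h0.ne'
    simp
    field_simp
    ring
  · apply ContinuousOn.intervalIntegrable
    rw [Set.uIcc_of_le (by norm_num)]
    refine ContinuousOn.div (ContinuousOn.log (by fun_prop) ?_) (by fun_prop) ?_
    · intro x hx
      have := hx.1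
      positivity
    · intro x hx
      have := hx.1
      positivity
end

section
/- Σ_{n=1}^∞ [ 2^n · ( Σ_{k=1}^n (3/2)^k / k ) ] / [ (2n+1)·binom(2n, n) ] = (π/2)·log 2 + (10/3)·G − (2π/3)·log(2 + √3). -/
open Real MeasureTheory intervalIntegral Finset

/-- Inverse tangent integral Ti₂(x) = ∫₀ˣ arctan u / u du. -/
noncomputable def Ti2 (x : ℝ) : ℝ := ∫ u in (0:ℝ)..x, Real.arctan u / u

/-- Catalan's constant G = Σ_{k≥0} (-1)^k/(2k+1)². -/
noncomputable def catalanG : ℝ := ∑' k : ℕ, (-1 : ℝ) ^ k / (2 * (k : ℝ) + 1) ^ 2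

noncomputable def Tfun (x : ℝ) : ℝ := ∑' k : ℕ, (-1 : ℝ) ^ k * x ^ (2 * k + 1) / (2 * (k : ℝ) + 1) ^ 2

lemma Tfun_one : Tfun 1 = catalanG := by
  simp [Tfun, catalanG]

lemma Tfun_neg (x : ℝ) : Tfun (-x) = - Tfun x := by
  unfold Tfun
  rw [← tsum_neg]
  congr 1; ext k
  rw [Odd.neg_pow ⟨k, rfl⟩]; ring

lemma summable_odd_sq : Summable (fun k : ℕ => 1 / (2 * (k : ℝ) + 1) ^ 2) := by
  have h := (summable_nat_add_iff 1).2 (Real.summable_one_div_nat_pow (p := 2)|>.2 (by norm_num))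
  refine Summable.of_nonneg_of_le (fun k => by positivity) (fun k => ?_) h
  push_cast
  apply one_div_le_one_div_of_le (by positivity)
  gcongr
  linarith [(Nat.cast_nonneg k : (0:ℝ) ≤ k)]

lemma Tfun_bound (k : ℕ) (x : ℝ) (hx : |x| ≤ 1) :
    ‖(-1 : ℝ) ^ k * x ^ (2 * k + 1) / (2 * (k : ℝ) + 1) ^ 2‖ ≤ 1 / (2 * (k : ℝ) + 1) ^ 2 := by
  rw [norm_div, norm_mul, norm_pow, norm_pow, norm_neg, norm_one, one_pow, one_mul,
    Real.norm_of_nonneg (by positivity : (0:ℝ) ≤ (2 * (k : ℝ) + 1) ^ 2)]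
  gcongr
  exact pow_le_one₀ (norm_nonneg _) hx

lemma Tfun_cont : ContinuousOn Tfun (Set.Icc (-1) 1) := by
  refine continuousOn_tsum (fun i => by fun_prop) summable_odd_sq (fun k x hx => Tfun_bound k x (abs_le.2 hx))

lemma Tfun_hasSum (x : ℝ) (hx : |x| ≤ 1) :
    HasSum (fun k : ℕ => (-1 : ℝ) ^ k * x ^ (2 * k + 1) / (2 * (k : ℝ) + 1) ^ 2) (Tfun x) :=
  (Summable.of_norm_bounded summable_odd_sq (fun k => Tfun_bound k x hx)).hasSum

lemma Tfun_deriv (x : ℝ) (h0 : 0 < x) (h1 : x < 1) : HasDerivAt Tfun (Real.arctan x / x) x := by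
  obtain ⟨ρ, hρ, hρ1⟩ := exists_between h1
  have hs : Summable (fun k : ℕ => ρ ^ (2 * k)) := by
    simp_rw [pow_mul]
    exact summable_geometric_of_lt_one (by positivity) (by nlinarith)
  have key := hasDerivAt_tsum_of_isPreconnected (𝕜 := ℝ) (F := ℝ) (y₀ := x) (y := x)
    (g := fun (k : ℕ) x => (-1 : ℝ) ^ k * x ^ (2 * k + 1) / (2 * (k : ℝ) + 1) ^ 2)
    (g' := fun (k : ℕ) x => (-1 : ℝ) ^ k * x ^ (2 * k) / (2 * (k : ℝ) + 1))
    (t := Set.Ioo (-ρ) ρ) hs isOpen_Ioo isPreconnected_Ioo ?_ ?_ ⟨by linarith, hρ⟩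
    (Tfun_hasSum x (by rw [abs_of_pos h0]; exact h1.le)).summable ⟨by linarith, hρ⟩
  · have h2 := (Real.hasSum_arctan (x := x) (by rw [Real.norm_of_nonneg h0.le]; exact h1)).div_const x
    have h3 : ∑' k : ℕ, (-1 : ℝ) ^ k * x ^ (2 * k) / (2 * (k : ℝ) + 1) = Real.arctan x / x := by
      rw [← h2.tsum_eq]
      congr 1; ext k
      push_cast
      field_simp
      ring
    rw [h3] at key
    exact key
  · intro k y _
    have := ((hasDerivAt_pow (2 * k + 1) y).const_mul ((-1:ℝ)^k)).div_const ((2 * (k : ℝ) + 1) ^ 2)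
    refine this.congr_deriv ?_
    push_cast
    field_simp
  · intro k y hy
    rw [norm_div, norm_mul, norm_pow, norm_pow, norm_neg, norm_one, one_pow, one_mul,
      Real.norm_of_nonneg (by positivity : (0:ℝ) ≤ (2 * (k : ℝ) + 1))]
    calc ‖y‖ ^ (2*k) / (2 * (k:ℝ) + 1) ≤ ‖y‖ ^ (2*k) := div_le_self (by positivity) (by linarith [(Nat.cast_nonneg k : (0:ℝ) ≤ k)])
      _ ≤ ρ ^ (2*k) := by
        gcongr
        exact abs_le.2 ⟨hy.1.le, hy.2.le⟩

noncomputable def Lfun (x : ℝ) : ℝ := Tfun (Real.tan x) - x * Real.log (Real.tan x)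

lemma tan_bds {x : ℝ} (h0 : 0 < x) (h1 : x < π / 4) : 0 < Real.tan x ∧ Real.tan x < 1 := by
  refine ⟨Real.tan_pos_of_pos_of_lt_pi_div_two h0 (by linarith), ?_⟩
  rw [← Real.tan_pi_div_four]
  exact Real.tan_lt_tan_of_lt_of_lt_pi_div_two (by linarith) (by linarith [Real.pi_pos]) h1

lemma Lfun_deriv {x : ℝ} (h0 : 0 < x) (h1 : x < π / 4) :
    HasDerivAt Lfun (-Real.log (Real.tan x)) x := by
  obtain ⟨t0, t1⟩ := tan_bds h0 h1
  have hc : 0 < Real.cos x := Real.cos_pos_of_mem_Ioo ⟨by linarith, by linarith⟩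
  have ht := Real.hasDerivAt_tan hc.ne'
  have hT := (Tfun_deriv _ t0 t1).comp x ht
  have hl := (hasDerivAt_id x).mul (ht.log t0.ne')
  refine (hT.sub hl).congr_deriv ?_
  rw [Real.arctan_tan (by linarith) (by linarith)]
  simp only [id]
  field_simp
  ring

lemma Lfun_cont : ContinuousOn Lfun (Set.Icc 0 (π / 4)) := by
  have htan : ∀ x ∈ Set.Icc 0 (π/4), ContinuousAt Real.tan x := fun x hx =>
    Real.continuousAt_tan.2 (Real.cos_pos_of_mem_Ioo ⟨by linarith [hx.1, Real.pi_pos], by linarith [hx.2, Real.pi_pos]⟩).ne'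
  have htanc : ContinuousOn Real.tan (Set.Icc 0 (π/4)) := fun x hx => (htan x hx).continuousWithinAt
  refine ContinuousOn.sub (Tfun_cont.comp htanc ?_) ?_
  · intro x hx
    have := Real.tan_nonneg_of_nonneg_of_le_pi_div_two hx.1 (by linarith [hx.2, Real.pi_pos])
    refine ⟨by linarith, ?_⟩
    rcases hx.2.lt_or_eq with h | h
    · rcases hx.1.lt_or_eq with h' | h'
      · exact (tan_bds h' h).2.le
      · simp [← h']
    · simp [h]
  · intro x hx
    rcases hx.1.lt_or_eq with h | h
    · have : 0 < Real.tan x := Real.tan_pos_of_pos_of_lt_pi_div_two h (by linarith [hx.2, Real.pi_pos])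
      exact (continuousAt_id.mul ((htan x hx).log this.ne')).continuousWithinAt
    · subst h
      unfold ContinuousWithinAt
      simp only [zero_mul]
      have hlim : Filter.Tendsto (fun y => ‖Real.tan y * Real.log (Real.tan y)‖) (nhdsWithin 0 (Set.Icc 0 (π/4))) (nhds 0) := by
        have h1 : ContinuousAt (fun y => ‖Real.tan y * Real.log (Real.tan y)‖) 0 :=
          (ContinuousAt.comp (g := fun x => x * Real.log x) Real.continuous_mul_log.continuousAt (htan 0 hx)).norm
        have h2 := h1.tendsto.mono_left (nhdsWithin_le_nhds (s := Set.Icc 0 (π/4)))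
        simpa using h2
      refine squeeze_zero_norm' ?_ hlim
      filter_upwards [self_mem_nhdsWithin] with y hy
      rw [norm_mul, norm_mul]
      gcongr
      rw [Real.norm_of_nonneg hy.1]
      exact (Real.le_tan hy.1 (by linarith [hy.2, Real.pi_pos])).trans (le_abs_self _)

lemma tan_triple {x : ℝ} (h0 : 0 < x) (h1 : x < π / 12) :
    Real.tan (3 * x) * (Real.tan (π/6 + x) * Real.tan (π/6 - x)) = Real.tan x := by
  have hp := Real.pi_pos
  have c3 : 0 < Real.cos (3*x) := Real.cos_pos_of_mem_Ioo ⟨by linarith, by linarith⟩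
  have c1 : 0 < Real.cos x := Real.cos_pos_of_mem_Ioo ⟨by linarith, by linarith⟩
  have cp : 0 < Real.cos (π/6+x) := Real.cos_pos_of_mem_Ioo ⟨by linarith, by linarith⟩
  have cm : 0 < Real.cos (π/6-x) := Real.cos_pos_of_mem_Ioo ⟨by linarith, by linarith⟩
  simp only [Real.tan_eq_sin_div_cos]
  rw [div_mul_div_comm, div_mul_div_comm, div_eq_div_iff (by positivity) (by positivity)]
  rw [Real.cos_add, Real.cos_sub, Real.sin_add, Real.sin_sub, Real.sin_three_mul, Real.cos_three_mul,
    Real.sin_pi_div_six, Real.cos_pi_div_six]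
  have hs : Real.sqrt 3 ^ 2 = 3 := Real.sq_sqrt (by norm_num)
  have h := Real.sin_sq_add_cos_sq x
  have hc : Real.cos x ^ 2 = 1 - Real.sin x ^ 2 := by linarith
  generalize Real.sin x = s at *
  generalize Real.cos x = c at *
  have e1 : (1 / 2 * c + √3 / 2 * s) * (1 / 2 * c - √3 / 2 * s) = 1/4 - s^2 := by
    linear_combination (1/4) * hc - s^2/4 * hs
  have e2 : (√3 / 2 * c - 1 / 2 * s) * (√3 / 2 * c + 1 / 2 * s) = 3/4 - s^2 := by
    linear_combination (3/4) * hc + c^2/4 * hs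
  have e3 : 4 * c^3 - 3 * c = c * (1 - 4 * s^2) := by linear_combination 4 * c * hc
  rw [e3]
  linear_combination (3 * s - 4 * s^3) * c * e1 - s * c * (1 - 4 * s^2) * e2

lemma Lfun_val : Lfun (π / 12) = 2 / 3 * catalanG := by
  have hp := Real.pi_pos
  have hcont : ContinuousOn (fun x => Lfun (3 * x) / 3 - Lfun x + Lfun (π/6 + x) - Lfun (π/6 - x)) (Set.Icc 0 (π/12)) := by
    have a1 : ContinuousOn (fun x => Lfun (3 * x)) (Set.Icc 0 (π/12)) :=
      Lfun_cont.comp (by fun_prop) (fun x hx => ⟨by linarith [hx.1], by linarith [hx.2]⟩)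
    have a2 : ContinuousOn (fun x => Lfun x) (Set.Icc 0 (π/12)) :=
      Lfun_cont.comp (by fun_prop) (fun x hx => ⟨by linarith [hx.1], by linarith [hx.2]⟩)
    have a3 : ContinuousOn (fun x => Lfun (π/6 + x)) (Set.Icc 0 (π/12)) :=
      Lfun_cont.comp (by fun_prop) (fun x hx => ⟨by linarith [hx.1], by linarith [hx.2]⟩)
    have a4 : ContinuousOn (fun x => Lfun (π/6 - x)) (Set.Icc 0 (π/12)) :=
      Lfun_cont.comp (by fun_prop) (fun x hx => ⟨by linarith [hx.2], by linarith [hx.1]⟩)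
    exact (((a1.div_const 3).sub a2).add a3).sub a4
  have hder : ∀ x ∈ Set.Ioo 0 (π/12), HasDerivAt (fun x => Lfun (3 * x) / 3 - Lfun x + Lfun (π/6 + x) - Lfun (π/6 - x)) ((fun _ => 0) x) x := by
    intro x hx
    obtain ⟨h0, h1⟩ := hx
    have d1 := (Lfun_deriv (x := 3 * x) (by linarith) (by linarith)).comp x ((hasDerivAt_id x).const_mul 3)
    have d2 := Lfun_deriv (x := x) (by linarith) (by linarith)
    have d3 := (Lfun_deriv (x := π/6 + x) (by linarith) (by linarith)).comp x ((hasDerivAt_id x).const_add (π/6))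
    have d4 := (Lfun_deriv (x := π/6 - x) (by linarith) (by linarith)).comp x ((hasDerivAt_id x).const_sub (π/6))
    refine ((((d1.div_const 3).sub d2).add d3).sub d4).congr_deriv ?_
    have t1 := (tan_bds (x := 3 * x) (by linarith) (by linarith)).1
    have t3 := (tan_bds (x := π/6 + x) (by linarith) (by linarith)).1
    have t4 := (tan_bds (x := π/6 - x) (by linarith) (by linarith)).1
    rw [← tan_triple h0 h1, Real.log_mul t1.ne' (mul_pos t3 t4).ne', Real.log_mul t3.ne' t4.ne']
    simp
    ring
  obtain ⟨c, hc, h⟩ := exists_hasDerivAt_eq_slope (fun x => Lfun (3 * x) / 3 - Lfun x + Lfun (π/6 + x) - Lfun (π/6 - x)) (fun _ => 0)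
    (a := 0) (b := π/12) (by positivity) hcont hder
  have h4 : Lfun (π/4) = catalanG := by simp [Lfun, Tfun_one]
  rw [eq_div_iff (by linarith)] at h
  have e1 : 3 * (π/12) = π/4 := by ring
  have e2 : π/6 + π/12 = π/4 := by ring
  have e3 : π/6 - π/12 = π/12 := by ring
  simp only [e1, e2, e3, h4, mul_zero, add_zero, sub_zero] at h
  have h0 : Lfun 0 = 0 := by simp [Lfun, Tfun]
  rw [h0] at h
  linarith

lemma tan_pi12 : Real.tan (π / 12) = 2 - √3 := by
  have hs : √3 ^ 2 = 3 := Real.sq_sqrt (by norm_num)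
  have hs0 := Real.sqrt_nonneg 3
  have hp := Real.pi_pos
  have c : 0 < Real.cos (π/12) := Real.cos_pos_of_mem_Ioo ⟨by linarith, by linarith⟩
  have h1 := Real.sin_two_mul (π/12)
  have h2 := Real.cos_two_mul (π/12)
  rw [show 2 * (π/12) = π/6 by ring] at h1 h2
  rw [Real.sin_pi_div_six] at h1
  rw [Real.cos_pi_div_six] at h2
  rw [Real.tan_eq_sin_div_cos, div_eq_iff c.ne']
  apply mul_left_cancel₀ c.ne'
  linear_combination -h1/2 + (2-√3)/2*h2 + hs/4

lemma Tfun_val : Tfun (2 - √3) = 2 / 3 * catalanG - π / 12 * Real.log (2 + √3) := by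
  have h := Lfun_val
  have hs : √3 ^ 2 = 3 := Real.sq_sqrt (by norm_num)
  have hi : 2 - √3 = (2 + √3)⁻¹ := by
    apply eq_inv_of_mul_eq_one_left
    linear_combination -hs
  have hl : Real.log (2 - √3) = - Real.log (2 + √3) := by rw [hi, Real.log_inv]
  rw [Lfun, tan_pi12, hl] at h
  linarith

lemma fourier_log (r φ : ℝ) (hr : |r| < 1) :
    HasSum (fun k : ℕ => r ^ k * Real.cos (k * φ) / k)
      (-(1 / 2) * Real.log (1 - 2 * r * Real.cos φ + r ^ 2)) := by
  have hz : ‖(r : ℂ) * Complex.exp (φ * Complex.I)‖ < 1 := by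
    rw [norm_mul, Complex.norm_exp_ofReal_mul_I, mul_one]; simpa using hr
  have h := Complex.hasSum_re (Complex.hasSum_taylorSeries_neg_log hz)
  have hn : ‖1 - (r : ℂ) * Complex.exp (φ * Complex.I)‖ ^ 2 = 1 - 2 * r * Real.cos φ + r ^ 2 := by
    rw [Complex.sq_norm, Complex.normSq_apply]
    simp only [Complex.sub_re, Complex.sub_im, Complex.one_re, Complex.one_im, Complex.re_ofReal_mul,
      Complex.im_ofReal_mul, Complex.exp_ofReal_mul_I_re, Complex.exp_ofReal_mul_I_im]
    linear_combination r ^ 2 * Real.sin_sq_add_cos_sq φ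
  rw [Complex.neg_re, Complex.log_re] at h
  have e : -(1 / 2) * Real.log (1 - 2 * r * Real.cos φ + r ^ 2) =
      -Real.log ‖1 - (r : ℂ) * Complex.exp (φ * Complex.I)‖ := by
    rw [← hn, Real.log_pow]; push_cast; ring
  rw [e]
  convert h using 2 with k
  rw [mul_pow, ← Complex.exp_nat_mul, ← mul_assoc, ← Complex.ofReal_natCast, ← Complex.ofReal_mul,
    ← Complex.ofReal_pow, Complex.div_ofReal_re, Complex.re_ofReal_mul, Complex.exp_ofReal_mul_I_re]

lemma hasSum_sin (r : ℝ) (hr : |r| ≤ 1) :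
    HasSum (fun k : ℕ => r ^ k * Real.sin (k * (π / 2)) / (k : ℝ) ^ 2) (Tfun r) := by
  have h := Tfun_hasSum r hr
  have h0 : HasSum (fun k : ℕ => r ^ (2 * k) * Real.sin ((2 * k : ℕ) * (π / 2)) / ((2 * k : ℕ) : ℝ) ^ 2) 0 := by
    convert (hasSum_zero : HasSum (fun _ : ℕ => (0 : ℝ)) 0) using 2 with k
    have : ((2 * k : ℕ) : ℝ) * (π / 2) = k * π := by push_cast; ring
    rw [this, Real.sin_nat_mul_pi]; simp
  have h1 : HasSum (fun k : ℕ => r ^ (2 * k + 1) * Real.sin ((2 * k + 1 : ℕ) * (π / 2)) / ((2 * k + 1 : ℕ) : ℝ) ^ 2) (Tfun r) := by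
    convert h using 2 with k
    have : ((2 * k + 1 : ℕ) : ℝ) * (π / 2) = k * π + π / 2 := by push_cast; ring
    rw [this, Real.sin_add_pi_div_two, Real.cos_nat_mul_pi]
    push_cast; ring
  have := HasSum.even_add_odd (f := fun k : ℕ => r ^ k * Real.sin (k * (π / 2)) / (k : ℝ) ^ 2) h0 h1
  simpa using this

lemma int_log_lt (r : ℝ) (hr : |r| < 1) :
    ∫ φ in (0:ℝ)..(π / 2), Real.log (1 - 2 * r * Real.cos φ + r ^ 2) = -2 * Tfun r := by
  have h := intervalIntegral.hasSum_integral_of_dominated_convergence (a := 0) (b := π / 2)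
    (μ := volume) (F := fun (k : ℕ) φ => r ^ k * Real.cos (k * φ) / k)
    (f := fun φ => -(1 / 2) * Real.log (1 - 2 * r * Real.cos φ + r ^ 2))
    (fun k _ => |r| ^ k)
    (fun k => (by fun_prop : Continuous (fun φ => r ^ k * Real.cos (k * φ) / k)).aestronglyMeasurable)
    (fun k => Filter.Eventually.of_forall (fun φ _ => by
      rw [norm_div, norm_mul, norm_pow, Real.norm_eq_abs r]
      rcases Nat.eq_zero_or_pos k with rfl | hk
      · simp
      · have hk1 : (1:ℝ) ≤ ‖(k:ℝ)‖ := by simpa using (by exact_mod_cast hk : (1:ℝ) ≤ k)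
        have hc : ‖Real.cos (k * φ)‖ ≤ 1 := Real.abs_cos_le_one _
        refine (div_le_self (by positivity) hk1).trans ?_
        exact mul_le_of_le_one_right (by positivity) hc))
    (Filter.Eventually.of_forall (fun _ _ => summable_geometric_of_lt_one (abs_nonneg _) hr))
    (by simp)
    (Filter.Eventually.of_forall (fun φ _ => fourier_log r φ hr))
  have h2 : (fun k : ℕ => ∫ φ in (0:ℝ)..(π / 2), r ^ k * Real.cos (k * φ) / k) =
      (fun k : ℕ => r ^ k * Real.sin (k * (π / 2)) / (k : ℝ) ^ 2) := by
    ext k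
    rcases Nat.eq_zero_or_pos k with rfl | hk
    · simp
    · have hk' : (k : ℝ) ≠ 0 := by positivity
      rw [intervalIntegral.integral_div, intervalIntegral.integral_const_mul,
        intervalIntegral.integral_comp_mul_left (fun x => Real.cos x) hk', integral_cos]
      simp
      field_simp
  rw [h2, intervalIntegral.integral_const_mul] at h
  have := h.unique (hasSum_sin r hr.le)
  linarith

lemma int_log_neg_one :
    ∫ φ in (0:ℝ)..(π / 2), Real.log (1 - 2 * (-1) * Real.cos φ + (-1) ^ 2) = -2 * Tfun (-1) := by
  have hp := Real.pi_pos
  let F : ℝ → ℝ → ℝ := fun r φ => Real.log (1 + 2 * |r| * |Real.cos φ| + r ^ 2)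
  have hF : Continuous (Function.uncurry F) := by
    apply Continuous.log
    · fun_prop
    · rintro ⟨r, φ⟩
      simp only
      positivity
  have hc := intervalIntegral.continuous_parametric_intervalIntegral_of_continuous' (μ := volume) hF 0 (π / 2)
  have hFe : ∀ r : ℝ, r ≤ 0 → ∫ φ in (0:ℝ)..(π / 2), F r φ =
      ∫ φ in (0:ℝ)..(π / 2), Real.log (1 - 2 * r * Real.cos φ + r ^ 2) := by
    intro r hr
    apply intervalIntegral.integral_congr
    intro φ hφ
    rw [Set.uIcc_of_le (by positivity)] at hφ
    simp only [F]
    rw [abs_of_nonpos hr, abs_of_nonneg (Real.cos_nonneg_of_mem_Icc ⟨by linarith [hφ.1], hφ.2⟩)]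
    congr 1; ring
  have t1 : Filter.Tendsto (fun r => ∫ φ in (0:ℝ)..(π / 2), F r φ) (nhdsWithin (-1) (Set.Ioo (-1) 0))
      (nhds (∫ φ in (0:ℝ)..(π / 2), F (-1) φ)) := hc.continuousAt.tendsto.mono_left nhdsWithin_le_nhds
  have t2 : Filter.Tendsto (fun r => -2 * Tfun r) (nhdsWithin (-1) (Set.Ioo (-1) 0))
      (nhds (-2 * Tfun (-1))) := by
    apply Filter.Tendsto.const_mul
    exact ((Tfun_cont (-1) (by norm_num)).mono (fun x hx => ⟨hx.1.le, by linarith [hx.2]⟩)).tendsto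
  have hne : (nhdsWithin (-1:ℝ) (Set.Ioo (-1) 0)).NeBot := by
    rw [nhdsWithin_Ioo_eq_nhdsGT (by norm_num)]; infer_instance
  rw [← hFe (-1) (by norm_num)]
  refine tendsto_nhds_unique (t1.congr' ?_) t2
  filter_upwards [self_mem_nhdsWithin] with r hr
  rw [hFe r hr.2.le, int_log_lt r (abs_lt.2 ⟨hr.1, by linarith [hr.2]⟩)]

lemma J_val : ∫ t in (0:ℝ)..1, Real.log (1 + 3 * t ^ 2) / (1 + t ^ 2) =
    π / 4 * Real.log 2 + π / 3 * Real.log (2 + √3) - 5 / 3 * catalanG := by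
  have hp := Real.pi_pos
  have hs : √3 ^ 2 = 3 := Real.sq_sqrt (by norm_num)
  have hs0 := Real.sqrt_nonneg 3
  have hi : 2 - √3 = (2 + √3)⁻¹ := by
    apply eq_inv_of_mul_eq_one_left
    linear_combination -hs
  have hr0 : 0 < 2 - √3 := by rw [hi]; positivity
  have hl : Real.log (2 - √3) = - Real.log (2 + √3) := by rw [hi, Real.log_inv]
  have hcos : ∀ φ ∈ Set.uIcc 0 (π / 2), 0 < Real.cos (φ / 2) := by
    intro φ hφ
    rw [Set.uIcc_of_le (by positivity)] at hφ
    exact Real.cos_pos_of_mem_Ioo ⟨by linarith [hφ.1], by linarith [hφ.2]⟩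
  have sub := intervalIntegral.integral_comp_mul_deriv (a := 0) (b := π / 2)
    (f := fun φ => Real.tan (φ / 2)) (f' := fun φ => 1 / Real.cos (φ / 2) ^ 2 * (1 / 2))
    (g := fun t => Real.log (1 + 3 * t ^ 2) / (1 + t ^ 2))
    (fun φ hφ => HasDerivAt.comp (h₂ := Real.tan) (h := fun φ => φ / 2) φ (Real.hasDerivAt_tan (hcos φ hφ).ne') ((hasDerivAt_id φ).div_const 2))
    (by
      refine ContinuousOn.mul (ContinuousOn.div (by fun_prop) (by fun_prop) ?_) (by fun_prop)
      intro φ hφ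
      exact (pow_pos (hcos φ hφ) 2).ne')
    (by
      refine Continuous.div (Continuous.log (by fun_prop) ?_) (by fun_prop) ?_
      · intro x; positivity
      · intro x; positivity)
  rw [zero_div, Real.tan_zero, show π / 2 / 2 = π / 4 by ring, Real.tan_pi_div_four] at sub
  rw [← sub]
  have r1 : |2 - √3| < 1 := by
    rw [abs_of_pos hr0]; nlinarith
  have h1 := int_log_lt (2 - √3) r1
  have h2 := int_log_neg_one
  have pos1 : ∀ φ, 0 < 1 - 2 * (2 - √3) * Real.cos φ + (2 - √3) ^ 2 := by
    intro φ
    have := Real.cos_le_one φ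
    have e : 1 - 2 * (2 - √3) * Real.cos φ + (2 - √3) ^ 2 = 2 * (2 - √3) * (2 - Real.cos φ) := by
      linear_combination hs
    rw [e]
    exact mul_pos (by linarith) (by linarith)
  have hcos' : ∀ φ ∈ Set.uIcc 0 (π / 2), 0 ≤ Real.cos φ := by
    intro φ hφ
    rw [Set.uIcc_of_le (by positivity)] at hφ
    exact Real.cos_nonneg_of_mem_Icc ⟨by linarith [hφ.1], by linarith [hφ.2]⟩
  have i1 : IntervalIntegrable (fun φ => Real.log (1 - 2 * (2 - √3) * Real.cos φ + (2 - √3) ^ 2)) volume 0 (π / 2) :=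
    (Continuous.log (by fun_prop) (fun φ => (pos1 φ).ne')).intervalIntegrable _ _
  have i2 : IntervalIntegrable (fun φ => Real.log (1 - 2 * (-1) * Real.cos φ + (-1) ^ 2)) volume 0 (π / 2) := by
    apply ContinuousOn.intervalIntegrable
    refine ContinuousOn.log (by fun_prop) (fun φ hφ => ?_)
    have := hcos' φ hφ
    nlinarith
  have e : ∫ φ in (0:ℝ)..(π / 2), ((fun t => Real.log (1 + 3 * t ^ 2) / (1 + t ^ 2)) ∘ fun φ => Real.tan (φ / 2)) φ
        * (1 / Real.cos (φ / 2) ^ 2 * (1 / 2)) =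
      ∫ φ in (0:ℝ)..(π / 2), (((1 / 2) * Real.log (1 - 2 * (2 - √3) * Real.cos φ + (2 - √3) ^ 2)
        - (1 / 2) * Real.log (1 - 2 * (-1) * Real.cos φ + (-1) ^ 2)) +
          ((1 / 2) * Real.log 2 + (1 / 2) * Real.log (2 + √3))) := by
    apply intervalIntegral.integral_congr
    intro φ hφ
    have c0 := hcos φ hφ
    have c1 := hcos' φ hφ
    have d1 : 0 < 1 + Real.cos φ := by linarith
    have d2 : 0 < 2 - Real.cos φ := by linarith [Real.cos_le_one φ]
    have hc2 : Real.cos φ = 2 * Real.cos (φ / 2) ^ 2 - 1 := by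
      rw [← Real.cos_two_mul]; congr 1; ring
    have ht : 1 + Real.tan (φ / 2) ^ 2 = 1 / Real.cos (φ / 2) ^ 2 := by
      rw [Real.tan_eq_sin_div_cos]
      field_simp
      linarith [Real.sin_sq_add_cos_sq (φ / 2)]
    have ht3 : 1 + 3 * Real.tan (φ / 2) ^ 2 = 2 * (2 - Real.cos φ) / (1 + Real.cos φ) := by
      have : Real.tan (φ / 2) ^ 2 = 1 / Real.cos (φ / 2) ^ 2 - 1 := by linarith
      rw [this, hc2]
      field_simp
      ring
    have e1 : 1 - 2 * (2 - √3) * Real.cos φ + (2 - √3) ^ 2 = 2 * (2 - √3) * (2 - Real.cos φ) := by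
      linear_combination hs
    have e2 : 1 - 2 * (-1) * Real.cos φ + (-1) ^ 2 = 2 * (1 + Real.cos φ) := by ring
    simp only [Function.comp]
    rw [ht, ht3, e1, e2, Real.log_div (by positivity) d1.ne', Real.log_mul (by norm_num) d2.ne',
      Real.log_mul (by positivity) d2.ne', Real.log_mul (by norm_num) hr0.ne',
      Real.log_mul (by norm_num) d1.ne', hl]
    field_simp
    ring
  rw [e, intervalIntegral.integral_add ((i1.const_mul _).sub (i2.const_mul _)) (by simp),
    intervalIntegral.integral_sub (i1.const_mul _) (i2.const_mul _), intervalIntegral.integral_const_mul,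
    intervalIntegral.integral_const_mul, h1, h2, Tfun_neg, Tfun_one, Tfun_val, intervalIntegral.integral_const]
  simp only [smul_eq_mul]
  ring

lemma wallis_int (n : ℕ) : ∫ t in (0:ℝ)..1, (1 - t ^ 2) ^ n =
    4 ^ n / ((2 * n + 1) * (Nat.choose (2 * n) n : ℝ)) := by
  induction n with
  | zero => simp
  | succ n ih =>
    have hd : ∀ t ∈ Set.uIcc (0:ℝ) 1, HasDerivAt (fun t : ℝ => t * (1 - t ^ 2) ^ (n + 1))
        ((2 * n + 3) * (1 - t ^ 2) ^ (n + 1) - 2 * (n + 1) * (1 - t ^ 2) ^ n) t := by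
      intro t _
      have h1 := (hasDerivAt_id t).mul ((((hasDerivAt_pow 2 t).const_sub 1)).pow (n + 1))
      refine h1.congr_deriv ?_
      simp only [id, Nat.add_sub_cancel, Pi.pow_apply]
      push_cast
      ring
    have h := intervalIntegral.integral_eq_sub_of_hasDerivAt hd
      (Continuous.intervalIntegrable (by fun_prop) _ _)
    rw [intervalIntegral.integral_sub (Continuous.intervalIntegrable (by fun_prop) _ _)
      (Continuous.intervalIntegrable (by fun_prop) _ _), intervalIntegral.integral_const_mul,
      intervalIntegral.integral_const_mul, ih] at h
    simp at h
    have hb := Nat.succ_mul_centralBinom_succ n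
    simp only [Nat.centralBinom] at hb
    have hb' : ((n:ℝ) + 1) * (Nat.choose (2 * (n + 1)) (n + 1) : ℝ) = 2 * (2 * n + 1) * (Nat.choose (2 * n) n : ℝ) := by
      exact_mod_cast hb
    have p1 : (0:ℝ) < (Nat.choose (2 * n) n : ℝ) := by
      exact_mod_cast Nat.choose_pos (by omega)
    have p2 : (0:ℝ) < (Nat.choose (2 * (n + 1)) (n + 1) : ℝ) := by
      exact_mod_cast Nat.choose_pos (by omega)
    push_cast
    generalize (Nat.choose (2 * n) n : ℝ) = A at *
    generalize (Nat.choose (2 * (n + 1)) (n + 1) : ℝ) = B at *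
    generalize (∫ t in (0:ℝ)..1, (1 - t ^ 2) ^ (n + 1)) = X at *
    have hA : A = (n + 1) * B / (2 * (2 * n + 1)) := by
      field_simp; linarith
    have hX : X = 2 * (n + 1) * (4 ^ n / ((2 * n + 1) * A)) / (2 * n + 3) := by
      field_simp; field_simp at h; linarith
    rw [hX, hA, pow_succ]
    field_simp
    ring

lemma pointwise_sum (y : ℝ) (h0 : 0 ≤ y) (h1 : y ≤ 1 / 2) :
    HasSum (fun n : ℕ => (∑ k ∈ Finset.range (n + 1), (3 / 2 : ℝ) ^ (k + 1) / (k + 1)) * y ^ (n + 1))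
      (-Real.log (1 - 3 / 2 * y) / (1 - y)) := by
  have hf := Real.hasSum_pow_div_log_of_abs_lt_one (x := 3 / 2 * y) (by rw [abs_of_nonneg (by positivity)]; linarith)
  have hg := hasSum_geometric_of_lt_one h0 (by linarith)
  have h := hasSum_sum_range_mul_of_summable_norm
    (f := fun n : ℕ => (3 / 2 * y) ^ (n + 1) / ((n:ℝ) + 1)) (g := fun n : ℕ => y ^ n)
    hf.summable.norm hg.summable.norm
  rw [hf.tsum_eq, hg.tsum_eq, ← div_eq_mul_inv] at h
  refine (congrArg (fun f => HasSum f _) (funext fun n => ?_)).mpr h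
  rw [Finset.sum_mul]
  apply Finset.sum_congr rfl
  intro k hk
  have hk' : k ≤ n := by simpa [Nat.lt_succ_iff] using hk
  have : y ^ (n + 1) = y ^ (k + 1) * y ^ (n - k) := by
    rw [← pow_add]; congr 1; omega
  rw [this, mul_pow]
  ring

theorem stmt_14 :
    ∑' n : ℕ, (2 : ℝ) ^ (n + 1)
        * (∑ k ∈ Finset.range (n + 1), (3 / 2 : ℝ) ^ (k + 1) / (k + 1))
        / ((2 * (n + 1) + 1) * (Nat.choose (2 * (n + 1)) (n + 1) : ℝ)) =
      (π / 2) * Real.log 2 + (10 / 3) * catalanG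
        - (2 * π / 3) * Real.log (2 + Real.sqrt 3) := by
  have hlog4 : Real.log 4 = 2 * Real.log 2 := by
    rw [show (4:ℝ) = 2 ^ 2 by norm_num, Real.log_pow]; norm_num
  have hy : ∀ t ∈ Set.uIoc (0:ℝ) 1, 0 ≤ (1 - t ^ 2) / 2 ∧ (1 - t ^ 2) / 2 ≤ 1 / 2 := by
    intro t ht
    rw [Set.uIoc_of_le zero_le_one] at ht
    constructor <;> nlinarith [ht.1, ht.2]
  have h := intervalIntegral.hasSum_integral_of_dominated_convergence (a := 0) (b := 1)
    (μ := volume) (F := fun (n : ℕ) t =>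
      (∑ k ∈ Finset.range (n + 1), (3 / 2 : ℝ) ^ (k + 1) / (k + 1)) * ((1 - t ^ 2) / 2) ^ (n + 1))
    (f := fun t => 4 * Real.log 2 * (1 / (1 + t ^ 2)) - 2 * (Real.log (1 + 3 * t ^ 2) / (1 + t ^ 2)))
    (fun n _ => (∑ k ∈ Finset.range (n + 1), (3 / 2 : ℝ) ^ (k + 1) / (k + 1)) * (1 / 2) ^ (n + 1))
    (fun n => Continuous.aestronglyMeasurable (by fun_prop))
    (fun n => Filter.Eventually.of_forall (fun t ht => by
      obtain ⟨a, b⟩ := hy t ht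
      have hS : 0 ≤ ∑ k ∈ Finset.range (n + 1), (3 / 2 : ℝ) ^ (k + 1) / (k + 1) :=
        Finset.sum_nonneg (fun k _ => by positivity)
      rw [Real.norm_of_nonneg (mul_nonneg hS (pow_nonneg a _))]
      gcongr))
    (Filter.Eventually.of_forall (fun _ _ => (pointwise_sum (1 / 2) (by norm_num) le_rfl).summable))
    (by simp)
    (Filter.Eventually.of_forall (fun t ht => by
      obtain ⟨a, b⟩ := hy t ht
      have hps := pointwise_sum _ a b
      have e1 : 1 - 3 / 2 * ((1 - t ^ 2) / 2) = (1 + 3 * t ^ 2) / 4 := by ring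
      have e2 : 1 - (1 - t ^ 2) / 2 = (1 + t ^ 2) / 2 := by ring
      have e3 : -Real.log (1 - 3 / 2 * ((1 - t ^ 2) / 2)) / (1 - (1 - t ^ 2) / 2) =
          4 * Real.log 2 * (1 / (1 + t ^ 2)) - 2 * (Real.log (1 + 3 * t ^ 2) / (1 + t ^ 2)) := by
        rw [e1, e2, Real.log_div (by positivity) (by norm_num), hlog4]
        field_simp
        ring
      rw [e3] at hps
      exact hps))
  have hc1 : Continuous (fun t : ℝ => 1 / (1 + t ^ 2)) :=
    Continuous.div (by fun_prop) (by fun_prop) (fun x => by positivity)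
  have hc2 : Continuous (fun t : ℝ => Real.log (1 + 3 * t ^ 2) / (1 + t ^ 2)) :=
    Continuous.div (Continuous.log (by fun_prop) (fun x => by positivity)) (by fun_prop) (fun x => by positivity)
  rw [intervalIntegral.integral_sub ((hc1.intervalIntegrable _ _).const_mul _) ((hc2.intervalIntegrable _ _).const_mul _),
    intervalIntegral.integral_const_mul, intervalIntegral.integral_const_mul, J_val,
    integral_one_div_one_add_sq, Real.arctan_one, Real.arctan_zero] at h
  have e : ∀ n : ℕ, (2 : ℝ) ^ (n + 1)
        * (∑ k ∈ Finset.range (n + 1), (3 / 2 : ℝ) ^ (k + 1) / (k + 1))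
        / ((2 * (n + 1) + 1) * (Nat.choose (2 * (n + 1)) (n + 1) : ℝ)) =
      ∫ t in (0:ℝ)..1, (∑ k ∈ Finset.range (n + 1), (3 / 2 : ℝ) ^ (k + 1) / (k + 1)) * ((1 - t ^ 2) / 2) ^ (n + 1) := by
    intro n
    simp_rw [div_pow (1 - _ ^ 2 : ℝ)]
    rw [intervalIntegral.integral_const_mul, intervalIntegral.integral_div, wallis_int,
      show (4:ℝ) ^ (n + 1) = 2 ^ (n + 1) * 2 ^ (n + 1) by rw [← mul_pow]; norm_num]
    push_cast
    field_simp
  rw [tsum_congr e, h.tsum_eq]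
  ring
end

section
/- For every real x > 0, ∫₀¹ log(1 + t^x)/(1 + t) dt + ∫₀¹ log(1 + t^(1/x))/(1 + t) dt = log²2. -/
open Real MeasureTheory intervalIntegral Finset

lemma aux_ge_one (x : ℝ) (hx : 1 ≤ x) :
    (∫ t in (0:ℝ)..1, Real.log (1 + t ^ x) / (1 + t))
      + (∫ t in (0:ℝ)..1, Real.log (1 + t ^ (1 / x)) / (1 + t)) = Real.log 2 ^ 2 := by
  have hx0 : 0 < x := by linarith
  have hI : Set.uIcc (0:ℝ) 1 = Set.Icc 0 1 := Set.uIcc_of_le zero_le_one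
  have hpos : ∀ t ∈ Set.Icc (0:ℝ) 1, 0 < 1 + t := fun t ht => by linarith [ht.1]
  have hposp : ∀ p : ℝ, ∀ t ∈ Set.Icc (0:ℝ) 1, 0 < 1 + t ^ p := fun p t ht => by
    have := Real.rpow_nonneg ht.1 p
    linarith
  have hcp : ∀ p : ℝ, 0 ≤ p → ContinuousOn (fun t : ℝ => t ^ p) (Set.Icc 0 1) := fun p hp =>
    (Real.continuous_rpow_const hp).continuousOn
  have hclog : ∀ p : ℝ, 0 ≤ p →
      ContinuousOn (fun t : ℝ => Real.log (1 + t ^ p)) (Set.Icc 0 1) := fun p hp =>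
    ContinuousOn.log (continuousOn_const.add (hcp p hp)) (fun t ht => (hposp p t ht).ne')
  have hc1 : ContinuousOn (fun t : ℝ => 1 + t) (Set.Icc 0 1) := by fun_prop
  have hcl1 : ContinuousOn (fun t : ℝ => Real.log (1 + t)) (Set.Icc 0 1) :=
    ContinuousOn.log hc1 (fun t ht => (hpos t ht).ne')
  have hd : ∀ t : ℝ, HasDerivAt (fun t : ℝ => t ^ x) (x * t ^ (x - 1)) t := fun t =>
    Real.hasDerivAt_rpow_const (Or.inr hx)
  have hd' : ContinuousOn (fun t : ℝ => x * t ^ (x - 1)) (Set.Icc 0 1) :=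
    continuousOn_const.mul (hcp _ (by linarith))
  have hinv : (0:ℝ) ≤ 1 / x := by positivity
  have hsub : (∫ t in (0:ℝ)..1, Real.log (1 + t ^ (1 / x)) / (1 + t))
      = ∫ s in (0:ℝ)..1, (x * s ^ (x - 1)) / (1 + s ^ x) * Real.log (1 + s) := by
    have h := integral_comp_mul_deriv' (a := 0) (b := 1) (f := fun t : ℝ => t ^ x)
      (f' := fun t : ℝ => x * t ^ (x - 1))
      (g := fun t : ℝ => Real.log (1 + t ^ (1 / x)) / (1 + t))
      (fun t _ => hd t) (by rw [hI]; exact hd') (by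
        rw [hI]
        refine ((hclog _ hinv).div hc1 (fun t ht => (hpos t ht).ne')).mono ?_
        rintro _ ⟨t, ht, rfl⟩
        exact ⟨Real.rpow_nonneg ht.1 _, Real.rpow_le_one ht.1 ht.2 hx0.le⟩)
    simp only [Real.zero_rpow hx0.ne', Real.one_rpow] at h
    rw [← h]
    apply integral_congr
    intro s hs
    rw [hI] at hs
    simp only [Function.comp]
    rw [← Real.rpow_mul hs.1, mul_one_div_cancel hx0.ne', Real.rpow_one]
    ring
  have hu' : ContinuousOn (fun s : ℝ => (x * s ^ (x - 1)) / (1 + s ^ x)) (Set.Icc 0 1) :=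
    hd'.div (continuousOn_const.add (hcp x hx0.le)) (fun t ht => (hposp x t ht).ne')
  have hv' : ContinuousOn (fun s : ℝ => 1 / (1 + s)) (Set.Icc 0 1) :=
    continuousOn_const.div hc1 (fun t ht => (hpos t ht).ne')
  have hp := integral_mul_deriv_eq_deriv_mul (a := 0) (b := 1)
    (u := fun t : ℝ => Real.log (1 + t ^ x)) (v := fun t : ℝ => Real.log (1 + t))
    (u' := fun s : ℝ => (x * s ^ (x - 1)) / (1 + s ^ x)) (v' := fun s : ℝ => 1 / (1 + s))
    (fun t ht => by
      rw [hI] at ht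
      exact ((hd t).const_add 1).log (hposp x t ht).ne')
    (fun t ht => by
      rw [hI] at ht
      exact ((hasDerivAt_id t).const_add 1).log (hpos t ht).ne')
    (ContinuousOn.intervalIntegrable (by rw [hI]; exact hu'))
    (ContinuousOn.intervalIntegrable (by rw [hI]; exact hv'))
  simp only [mul_one_div] at hp
  rw [hsub, hp]
  norm_num
  ring

theorem stmt_15 (x : ℝ) (hx : 0 < x) :
    (∫ t in (0:ℝ)..1, Real.log (1 + t ^ x) / (1 + t))
      + (∫ t in (0:ℝ)..1, Real.log (1 + t ^ (1 / x)) / (1 + t)) = Real.log 2 ^ 2 := by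
  rcases le_total 1 x with h | h
  · exact aux_ge_one x h
  · have := aux_ge_one (1 / x) (by rw [le_div_iff₀ hx]; linarith)
    rw [one_div_one_div] at this
    rw [add_comm]
    exact this
end

section
/- For every real x > 0, ∫₀¹ arctan(t^x)/(1 + t²) dt + ∫₀¹ arctan(t^(1/x))/(1 + t²) dt = π²/16. -/
open Real MeasureTheory intervalIntegral Finset

theorem stmt_16 (x : ℝ) (hx : 0 < x) :
    (∫ t in (0:ℝ)..1, Real.arctan (t ^ x) / (1 + t ^ 2))
      + (∫ t in (0:ℝ)..1, Real.arctan (t ^ (1 / x)) / (1 + t ^ 2)) = π ^ 2 / 16 := by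
  have hc : Continuous (fun t : ℝ => t ^ x) := Real.continuous_rpow_const hx.le
  have hd : ∀ t ∈ Set.Ioo (min (0:ℝ) 1) (max 0 1),
      HasDerivAt (fun t : ℝ => t ^ x) (x * t ^ (x - 1)) t := by
    intro t ht
    simp only [zero_le_one, inf_of_le_left, sup_of_le_right, Set.mem_Ioo] at ht
    exact Real.hasDerivAt_rpow_const (Or.inl ht.1.ne')
  have hn : ∀ t ∈ Set.Ioo (min (0:ℝ) 1) (max 0 1), 0 ≤ x * t ^ (x - 1) := by
    intro t ht
    simp only [zero_le_one, inf_of_le_left, sup_of_le_right, Set.mem_Ioo] at ht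
    have := ht.1
    positivity
  have hp : ∀ t : ℝ, 1 + t ^ 2 ≠ 0 := fun t => by positivity
  have h2 := integral_comp_mul_deriv_of_deriv_nonneg (a := 0) (b := 1)
    (g := fun t => Real.arctan (t ^ (1 / x)) / (1 + t ^ 2)) hc.continuousOn hd hn
  simp only [Real.zero_rpow hx.ne', Real.one_rpow] at h2
  rw [← h2]
  have hu' : IntervalIntegrable (fun t : ℝ => 1 / (1 + t ^ 2)) volume 0 1 :=
    Continuous.intervalIntegrable (continuous_const.div (by fun_prop) hp) _ _
  have hv' : IntervalIntegrable (fun t : ℝ => 1 / (1 + (t ^ x) ^ 2) * (x * t ^ (x - 1)))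
      volume 0 1 := by
    apply IntervalIntegrable.continuousOn_mul
    · exact (intervalIntegrable_rpow' (by linarith)).const_mul x
    · exact (continuous_const.div (by fun_prop) fun t => hp _).continuousOn
  have hI2 : IntervalIntegrable (fun t : ℝ => Real.arctan t *
      (1 / (1 + (t ^ x) ^ 2) * (x * t ^ (x - 1)))) volume 0 1 :=
    hv'.continuousOn_mul Real.continuous_arctan.continuousOn
  have hI1 : IntervalIntegrable (fun t : ℝ => 1 / (1 + t ^ 2) * Real.arctan (t ^ x)) volume 0 1 :=
    hu'.mul_continuousOn (Real.continuous_arctan.comp hc).continuousOn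
  have key := integral_deriv_mul_eq_sub_of_hasDerivAt (a := 0) (b := 1)
    (u := Real.arctan) (v := fun t => Real.arctan (t ^ x))
    Real.continuous_arctan.continuousOn (Real.continuous_arctan.comp hc).continuousOn
    (fun t _ => Real.hasDerivAt_arctan t) (fun t ht => (hd t ht).arctan) hu' hv'
  rw [intervalIntegral.integral_add hI1 hI2] at key
  have e1 : (∫ t in (0:ℝ)..1, Real.arctan (t ^ x) / (1 + t ^ 2))
      = ∫ t in (0:ℝ)..1, 1 / (1 + t ^ 2) * Real.arctan (t ^ x) := by
    congr 1; ext t; ring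
  have e2 : (∫ t in (0:ℝ)..1, ((fun t : ℝ => Real.arctan (t ^ (1 / x)) / (1 + t ^ 2)) ∘
        fun t : ℝ => t ^ x) t * (x * t ^ (x - 1)))
      = ∫ t in (0:ℝ)..1, Real.arctan t * (1 / (1 + (t ^ x) ^ 2) * (x * t ^ (x - 1))) := by
    apply intervalIntegral.integral_congr
    intro t ht
    rw [Set.uIcc_of_le zero_le_one] at ht
    have : (t ^ x) ^ (1 / x) = t := by
      rw [← Real.rpow_mul ht.1, mul_one_div_cancel hx.ne', Real.rpow_one]
    simp only [Function.comp, this]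
    ring
  rw [e1, e2, key]
  simp [Real.zero_rpow hx.ne']
  ring
end

section
/- For every real x > 0, ∫₀¹ arcsin(t^x)/√(1 − t²) dt + ∫₀¹ arcsin(t^(1/x))/√(1 − t²) dt = π²/4. -/
open Real MeasureTheory intervalIntegral Finset

theorem stmt_17 (x : ℝ) (hx : 0 < x) :
    (∫ t in (0:ℝ)..1, Real.arcsin (t ^ x) / Real.sqrt (1 - t ^ 2))
      + (∫ t in (0:ℝ)..1, Real.arcsin (t ^ (1 / x)) / Real.sqrt (1 - t ^ 2)) = π ^ 2 / 4 := by
  have himg : (fun t : ℝ => t ^ x) '' Set.Ioo 0 1 = Set.Ioo 0 1 := by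
    ext u
    constructor
    · rintro ⟨t, ⟨h0, h1⟩, rfl⟩
      exact ⟨Real.rpow_pos_of_pos h0 x, Real.rpow_lt_one h0.le h1 hx⟩
    · rintro ⟨h0, h1⟩
      refine ⟨u ^ (1 / x), ⟨Real.rpow_pos_of_pos h0 _, Real.rpow_lt_one h0.le h1 (by positivity)⟩, ?_⟩
      show (u ^ (1 / x)) ^ x = u
      rw [← Real.rpow_mul h0.le, one_div, inv_mul_cancel₀ hx.ne', Real.rpow_one]
  have hinj : Set.InjOn (fun t : ℝ => t ^ x) (Set.Ioo 0 1) := by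
    intro a ha b hb hab
    exact (Real.rpow_left_inj ha.1.le hb.1.le hx.ne').1 hab
  set A : ℝ → ℝ := fun t => Real.arcsin (t ^ x) / Real.sqrt (1 - t ^ 2) with hA
  set B : ℝ → ℝ := fun t => Real.arcsin t * (x * t ^ (x - 1) / Real.sqrt (1 - (t ^ x) ^ 2)) with hB
  have hcv : (∫ t in (0:ℝ)..1, Real.arcsin (t ^ (1 / x)) / Real.sqrt (1 - t ^ 2))
      = ∫ t in (0:ℝ)..1, B t := by
    rw [integral_of_le zero_le_one, integral_of_le zero_le_one, integral_Ioc_eq_integral_Ioo,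
      integral_Ioc_eq_integral_Ioo]
    conv_lhs => rw [← himg]
    rw [integral_image_eq_integral_abs_deriv_smul (f' := fun t => x * t ^ (x - 1))
      measurableSet_Ioo ?_ hinj]
    · refine setIntegral_congr_fun measurableSet_Ioo ?_
      rintro t ⟨h0, h1⟩
      have : 0 < t ^ (x - 1) := Real.rpow_pos_of_pos h0 _
      simp only [smul_eq_mul, hB]
      rw [abs_of_pos (by positivity), ← Real.rpow_mul h0.le, mul_one_div_cancel hx.ne',
        Real.rpow_one]
      ring
    · rintro t ⟨h0, h1⟩
      exact (Real.hasDerivAt_rpow_const (Or.inl h0.ne')).hasDerivWithinAt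
  have hA0 : ∀ t ∈ Set.Ioc (0:ℝ) 1, 0 ≤ A t := fun t ht =>
    div_nonneg (Real.arcsin_nonneg.2 (Real.rpow_nonneg ht.1.le _)) (Real.sqrt_nonneg _)
  have hB0 : ∀ t ∈ Set.Ioc (0:ℝ) 1, 0 ≤ B t := fun t ht =>
    mul_nonneg (Real.arcsin_nonneg.2 ht.1.le)
      (div_nonneg (mul_nonneg hx.le (Real.rpow_nonneg ht.1.le _)) (Real.sqrt_nonneg _))
  have hcont : ContinuousOn (fun t : ℝ => Real.arcsin t * Real.arcsin (t ^ x)) (Set.Icc 0 1) :=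
    (Real.continuous_arcsin.mul
      (Real.continuous_arcsin.comp (Real.continuous_rpow_const hx.le))).continuousOn
  have hder : ∀ t ∈ Set.Ioo (0:ℝ) 1,
      HasDerivAt (fun t : ℝ => Real.arcsin t * Real.arcsin (t ^ x)) (A t + B t) t := by
    rintro t ⟨h0, h1⟩
    have p0 : 0 < t ^ x := Real.rpow_pos_of_pos h0 x
    have p1 : t ^ x < 1 := Real.rpow_lt_one h0.le h1 hx
    have d1 := Real.hasDerivAt_arcsin (x := t) (by linarith) h1.ne
    have d2 := (Real.hasDerivAt_arcsin (x := t ^ x) (by linarith) p1.ne).comp t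
      (Real.hasDerivAt_rpow_const (p := x) (Or.inl h0.ne'))
    refine (d1.mul d2).congr_deriv ?_
    simp only [hA, hB, Function.comp]
    ring
  have hint : IntegrableOn (fun t => A t + B t) (Set.Ioc 0 1) :=
    integrableOn_deriv_of_nonneg hcont hder fun t ht =>
      add_nonneg (hA0 t ⟨ht.1, ht.2.le⟩) (hB0 t ⟨ht.1, ht.2.le⟩)
  have mA : Measurable A := by
    have := Real.measurable_arcsin
    fun_prop
  have mB : Measurable B := by
    have := Real.measurable_arcsin
    fun_prop
  have iA : IntegrableOn A (Set.Ioc 0 1) := by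
    refine Integrable.mono' hint mA.aestronglyMeasurable ?_
    refine (ae_restrict_iff' measurableSet_Ioc).2 (Filter.Eventually.of_forall fun t ht => ?_)
    rw [Real.norm_of_nonneg (hA0 t ht)]
    linarith [hB0 t ht]
  have iB : IntegrableOn B (Set.Ioc 0 1) := by
    refine Integrable.mono' hint mB.aestronglyMeasurable ?_
    refine (ae_restrict_iff' measurableSet_Ioc).2 (Filter.Eventually.of_forall fun t ht => ?_)
    rw [Real.norm_of_nonneg (hB0 t ht)]
    linarith [hA0 t ht]
  have e : ∀ {f : ℝ → ℝ}, IntegrableOn f (Set.Ioc 0 1) → IntervalIntegrable f volume 0 1 :=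
    fun h => (intervalIntegrable_iff_integrableOn_Ioc_of_le zero_le_one).2 h
  rw [hcv, ← intervalIntegral.integral_add (e iA) (e iB),
    integral_eq_sub_of_hasDerivAt_of_le zero_le_one hcont hder (e hint)]
  simp
  ring
end

section
/- For every real x > 0, ∫₀¹ log(1 − t)·Li₂(t^x)/t dt + ∫₀¹ log(1 − t)·Li₂(t^(1/x))/t dt = −π⁴/36. -/
open Real MeasureTheory intervalIntegral Finset

noncomputable def aa (x : ℝ) (p : ℕ × ℕ) : ℝ :=
  1 / (((p.1 : ℝ) + 1) * ((p.2 : ℝ) + 1) ^ 2 * ((p.1 : ℝ) + 1 + x * ((p.2 : ℝ) + 1)))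

noncomputable def FF (x : ℝ) (p : ℕ × ℕ) (t : ℝ) : ℝ :=
  (1 / (((p.1 : ℝ) + 1) * ((p.2 : ℝ) + 1) ^ 2)) * t ^ ((p.1 : ℝ) + x * ((p.2 : ℝ) + 1))

lemma aa_pos (x : ℝ) (hx : 0 < x) (p : ℕ × ℕ) : 0 < aa x p := by
  unfold aa; positivity

lemma aa_add (x : ℝ) (hx : 0 < x) (p : ℕ × ℕ) :
    aa x p + aa (1 / x) p.swap = (1 / ((p.1 : ℝ) + 1) ^ 2) * (1 / ((p.2 : ℝ) + 1) ^ 2) := by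
  unfold aa
  simp only [Prod.fst_swap, Prod.snd_swap]
  have h1 : (0 : ℝ) < (p.1 : ℝ) + 1 := by positivity
  have h2 : (0 : ℝ) < (p.2 : ℝ) + 1 := by positivity
  generalize (p.1 : ℝ) + 1 = n at *
  generalize (p.2 : ℝ) + 1 = k at *
  have h3 : k + 1 / x * n = (n + x * k) / x := by field_simp; ring
  have h4 : n + x * k ≠ 0 := by positivity
  rw [h3]
  field_simp

lemma zeta2 : HasSum (fun n : ℕ => 1 / ((n : ℝ) + 1) ^ 2) (π ^ 2 / 6) := by
  have h := (hasSum_nat_add_iff' 1).mpr hasSum_zeta_two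
  simpa using h

lemma prod_hasSum (f : ℕ → ℝ) (a : ℝ) (hf : ∀ n, 0 ≤ f n) (h : HasSum f a) :
    HasSum (fun p : ℕ × ℕ => f p.1 * f p.2) (a * a) := by
  have hs : Summable (fun p : ℕ × ℕ => f p.1 * f p.2) :=
    h.summable.mul_of_nonneg h.summable hf hf
  exact h.mul h hs

lemma zeta22 : HasSum (fun p : ℕ × ℕ => (1 / ((p.1 : ℝ) + 1) ^ 2) * (1 / ((p.2 : ℝ) + 1) ^ 2))
    (π ^ 2 / 6 * (π ^ 2 / 6)) :=
  prod_hasSum (fun n : ℕ => 1 / ((n : ℝ) + 1) ^ 2) (π ^ 2 / 6) (fun n => by positivity) zeta2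

lemma aa_summable (x : ℝ) (hx : 0 < x) : Summable (aa x) := by
  refine Summable.of_nonneg_of_le (fun p => (aa_pos x hx p).le) (fun p => ?_) zeta22.summable
  rw [← aa_add x hx p]
  linarith [aa_pos (1 / x) (by positivity) p.swap]

lemma FF_int (x : ℝ) (hx : 0 < x) (p : ℕ × ℕ) : ∫ t in (0:ℝ)..1, FF x p t = aa x p := by
  unfold FF aa
  have h : (0:ℝ) < (p.1 : ℝ) + x * ((p.2 : ℝ) + 1) := by positivity
  rw [intervalIntegral.integral_const_mul, integral_rpow (Or.inl (by linarith)),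
    Real.one_rpow, Real.zero_rpow (by linarith)]
  have h2 : (p.1 : ℝ) + x * ((p.2 : ℝ) + 1) + 1 = (p.1 : ℝ) + 1 + x * ((p.2 : ℝ) + 1) := by ring
  rw [h2]
  field_simp
  ring

lemma FF_intble (x : ℝ) (hx : 0 < x) (p : ℕ × ℕ) :
    IntervalIntegrable (FF x p) volume 0 1 := by
  unfold FF
  have h : (0:ℝ) < (p.1 : ℝ) + x * ((p.2 : ℝ) + 1) := by positivity
  exact (intervalIntegral.intervalIntegrable_rpow' (r := (p.1 : ℝ) + x * ((p.2 : ℝ) + 1)) (by linarith)).const_mul _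

lemma FF_tsum (x : ℝ) (hx : 0 < x) (t : ℝ) (ht : t ∈ Set.Ioo (0:ℝ) 1) :
    ∑' p, FF x p t = -(Real.log (1 - t) * Li2 (t ^ x) / t) := by
  obtain ⟨h0, h1⟩ := ht
  have hl := Real.hasSum_pow_div_log_of_abs_lt_one (x := t) (by rw [abs_of_pos h0]; exact h1)
  have hu0 : 0 ≤ t ^ x := by positivity
  have hu1 : t ^ x ≤ 1 := Real.rpow_le_one h0.le h1.le hx.le
  have hL : Summable (fun k : ℕ => (t ^ x) ^ (k + 1) / ((k : ℝ) + 1) ^ 2) := by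
    refine Summable.of_nonneg_of_le (fun k => by positivity) (fun k => ?_) zeta2.summable
    gcongr
    exact pow_le_one₀ hu0 hu1
  have hs := hl.summable.mul_of_nonneg hL (fun _ => by positivity) (fun _ => by positivity)
  have hm := (hl.mul hL.hasSum hs).div_const t
  have : (fun p : ℕ × ℕ => FF x p t) = fun p : ℕ × ℕ =>
      t ^ (p.1 + 1) / ((p.1 : ℝ) + 1) * ((t ^ x) ^ (p.2 + 1) / ((p.2 : ℝ) + 1) ^ 2) / t := by
    funext p
    unfold FF
    rw [Real.rpow_add h0, Real.rpow_natCast, Real.rpow_mul h0.le]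
    have : ((p.2 : ℝ) + 1) = ((p.2 + 1 : ℕ) : ℝ) := by push_cast; ring
    rw [this, Real.rpow_natCast, pow_succ t]
    field_simp
  rw [this, hm.tsum_eq]
  unfold Li2
  ring

lemma main_int (x : ℝ) (hx : 0 < x) :
    ∫ t in (0:ℝ)..1, Real.log (1 - t) * Li2 (t ^ x) / t = -∑' p, aa x p := by
  have hi : ∀ p, Integrable (FF x p) (volume.restrict (Set.Ioo (0:ℝ) 1)) := fun p =>
    (intervalIntegrable_iff_integrableOn_Ioo_of_le zero_le_one).mp (FF_intble x hx p)
  have he : ∀ p, ∫ t in Set.Ioo (0:ℝ) 1, FF x p t = aa x p := fun p => by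
    rw [← FF_int x hx p, intervalIntegral.integral_of_le zero_le_one, integral_Ioc_eq_integral_Ioo]
  have hn : ∀ p, ∫ t in Set.Ioo (0:ℝ) 1, ‖FF x p t‖ = aa x p := fun p => by
    rw [← he p]
    refine setIntegral_congr_fun measurableSet_Ioo (fun t ht => ?_)
    have := ht.1
    refine Real.norm_of_nonneg ?_
    unfold FF
    positivity
  have h := hasSum_integral_of_summable_integral_norm hi (by simpa only [hn] using aa_summable x hx)
  simp only [he] at h
  rw [h.tsum_eq, intervalIntegral.integral_of_le zero_le_one, integral_Ioc_eq_integral_Ioo,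
    ← MeasureTheory.integral_neg]
  refine setIntegral_congr_fun measurableSet_Ioo (fun t ht => ?_)
  simp only [FF_tsum x hx t ht, neg_neg]

theorem stmt_18 (x : ℝ) (hx : 0 < x) :
    (∫ t in (0:ℝ)..1, Real.log (1 - t) * Li2 (t ^ x) / t)
      + (∫ t in (0:ℝ)..1, Real.log (1 - t) * Li2 (t ^ (1 / x)) / t) = -(π ^ 4 / 36) := by
  have hx' : 0 < 1 / x := by positivity
  rw [main_int x hx, main_int (1 / x) hx']
  have h2 : HasSum (fun p : ℕ × ℕ => aa (1 / x) p.swap) (∑' p, aa (1 / x) p) :=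
    (Equiv.prodComm ℕ ℕ).hasSum_iff.mpr (aa_summable _ hx').hasSum
  have h3 := (aa_summable x hx).hasSum.add h2
  simp only [aa_add x hx] at h3
  have := h3.unique zeta22
  linarith
end

section
/- For every real x > 0, ∫₀^∞ arctan(t^x)/(t² + 1) dt + ∫₀^∞ arctan(t^(1/x))/(t² + 1) dt = π²/4. -/
open Real MeasureTheory intervalIntegral Finset

theorem aux_int (x : ℝ) (hx : 0 < x) :
    (∫ t in Set.Ioi (0:ℝ), Real.arctan (t ^ x) / (t ^ 2 + 1)) = π ^ 2 / 8 := by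
  have hb : IntegrableOn (fun t : ℝ => (1 + t ^ 2)⁻¹) (Set.Ioi 0) :=
    integrable_inv_one_add_sq.integrableOn
  have hi : IntegrableOn (fun t : ℝ => Real.arctan (t ^ x) / (t ^ 2 + 1)) (Set.Ioi 0) := by
    refine Integrable.mono' (hb.const_mul (π / 2)) ?_ ?_
    · apply Measurable.aestronglyMeasurable
      exact (Real.measurable_arctan.comp (measurable_id.pow_const x)).div (by fun_prop)
    · refine Filter.Eventually.of_forall fun t => ?_
      have h1 : 0 < t ^ 2 + 1 := by positivity
      rw [Real.norm_eq_abs, abs_div, abs_of_pos h1, div_eq_mul_inv, add_comm (t ^ 2)]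
      have h2 : |arctan (t ^ x)| ≤ π / 2 :=
        abs_le.2 ⟨(neg_pi_div_two_lt_arctan _).le, (arctan_lt_pi_div_two _).le⟩
      gcongr
  have h := integral_comp_rpow_Ioi (fun t : ℝ => Real.arctan (t ^ x) / (t ^ 2 + 1))
    (p := -1) (by norm_num)
  have h2 : (∫ t in Set.Ioi (0:ℝ), (|(-1:ℝ)| * t ^ ((-1:ℝ) - 1)) •
      (Real.arctan ((t ^ (-1:ℝ)) ^ x) / ((t ^ (-1:ℝ)) ^ 2 + 1)))
      = ∫ t in Set.Ioi (0:ℝ),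
        (π / 2 * (1 + t ^ 2)⁻¹ - Real.arctan (t ^ x) / (t ^ 2 + 1)) := by
    refine setIntegral_congr_fun measurableSet_Ioi fun t ht => ?_
    have ht : 0 < t := ht
    have e : t ^ ((-1:ℝ) - 1) = (t ^ 2)⁻¹ := by
      rw [show (-1:ℝ) - 1 = -((2:ℕ):ℝ) by norm_num, rpow_neg ht.le, rpow_natCast]
    have hp : 0 < t ^ x := rpow_pos_of_pos ht x
    simp only [e, rpow_neg_one, inv_rpow ht.le, arctan_inv_of_pos hp, smul_eq_mul]
    norm_num
    field_simp
    ring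
  rw [h2, integral_sub (hb.const_mul _) hi, MeasureTheory.integral_const_mul,
    integral_Ioi_inv_one_add_sq, arctan_zero] at h
  linarith

theorem stmt_19 (x : ℝ) (hx : 0 < x) :
    (∫ t in Set.Ioi (0:ℝ), Real.arctan (t ^ x) / (t ^ 2 + 1))
      + (∫ t in Set.Ioi (0:ℝ), Real.arctan (t ^ (1 / x)) / (t ^ 2 + 1)) = π ^ 2 / 4 := by
  rw [aux_int x hx, aux_int (1 / x) (by positivity)]
  ring
end
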